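/- Let (Ω, 𝔽, ℙ) be a probability space, let Y₁, …, Y_m : Ω → ℝ be integrable random variables, and let ψ⁺ ≥ 0 and ψ⁻ ≥ 0 be penalties. Then the optimal expected imbalance cost of the centralized (pooled) system is at most the sum of the optimal expected imbalance costs of the decentralized system: ⨅_{q ∈ ℝ} E[c(q, ∑_{i=1}^m Y_i)] ≤ ∑_{i=1}^m ⨅_{q ∈ ℝ} E[c(q, Y_i)]. -/

import Mathlib

open MeasureTheory

/-- Imbalance cost of an offer `q` against a realization `y`. -/
noncomputable def imbalanceCost (ψp ψm q y : ℝ) : ℝ :=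
  ψp * max (y - q) 0 + ψm * max (q - y) 0

lemma imbalanceCost_nonneg {ψp ψm : ℝ} (hψp : 0 ≤ ψp) (hψm : 0 ≤ ψm) (q y : ℝ) :
    0 ≤ imbalanceCost ψp ψm q y := by
  unfold imbalanceCost
  positivity

lemma integrable_imbalanceCost {Ω : Type*} [MeasurableSpace Ω] {P : Measure Ω}
    [IsFiniteMeasure P] (ψp ψm q : ℝ) {Y : Ω → ℝ} (hY : Integrable Y P) :
    Integrable (fun ω => imbalanceCost ψp ψm q (Y ω)) P :=
  ((hY.sub (integrable_const q)).pos_part.const_mul ψp).add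
    (((integrable_const q).sub hY).pos_part.const_mul ψm)

/-- The imbalance cost is subadditive: pooling offers and realizations does not increase it. -/
lemma imbalanceCost_sum_le {ψp ψm : ℝ} (hψp : 0 ≤ ψp) (hψm : 0 ≤ ψm)
    {ι : Type*} (s : Finset ι) (q y : ι → ℝ) :
    imbalanceCost ψp ψm (∑ i ∈ s, q i) (∑ i ∈ s, y i) ≤
      ∑ i ∈ s, imbalanceCost ψp ψm (q i) (y i) := by
  have key (u : ι → ℝ) : max (∑ i ∈ s, u i) 0 ≤ ∑ i ∈ s, max (u i) 0 :=
    max_le (Finset.sum_le_sum fun i _ => le_max_left _ _)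
      (Finset.sum_nonneg fun i _ => le_max_right _ _)
  unfold imbalanceCost
  rw [← Finset.sum_sub_distrib, ← Finset.sum_sub_distrib, Finset.sum_add_distrib,
    ← Finset.mul_sum, ← Finset.mul_sum]
  exact add_le_add (mul_le_mul_of_nonneg_left (key _) hψp)
    (mul_le_mul_of_nonneg_left (key _) hψm)

/-- In a multi-location newsvendor system, the optimal expected imbalance cost of the
centralized (pooled) system is at most the sum of the optimal expected imbalance costs
of the decentralized system. -/
theorem centralized_optimal_cost_le_decentralized
    {Ω : Type*} [MeasurableSpace Ω] (P : Measure Ω) [IsProbabilityMeasure P]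
    (ψp ψm : ℝ) (hψp : 0 ≤ ψp) (hψm : 0 ≤ ψm)
    (m : ℕ) (Y : Fin m → Ω → ℝ) (hY : ∀ i, Integrable (Y i) P) :
    ⨅ q : ℝ, ∫ ω, imbalanceCost ψp ψm q (∑ i, Y i ω) ∂P ≤
      ∑ i, ⨅ q : ℝ, ∫ ω, imbalanceCost ψp ψm q (Y i ω) ∂P := by
  have pooled_le (q : Fin m → ℝ) :
      ⨅ q : ℝ, ∫ ω, imbalanceCost ψp ψm q (∑ i, Y i ω) ∂P ≤
        ∑ i, ∫ ω, imbalanceCost ψp ψm (q i) (Y i ω) ∂P := by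
    have hbdd : BddBelow (Set.range fun q : ℝ =>
        ∫ ω, imbalanceCost ψp ψm q (∑ i, Y i ω) ∂P) := by
      refine ⟨0, ?_⟩
      rintro _ ⟨q, rfl⟩
      exact integral_nonneg fun ω => imbalanceCost_nonneg hψp hψm _ _
    refine (ciInf_le hbdd (∑ i, q i)).trans ?_
    rw [← integral_finsetSum _ fun i _ => integrable_imbalanceCost ψp ψm (q i) (hY i)]
    exact integral_mono
      (integrable_imbalanceCost ψp ψm _ (integrable_finsetSum _ fun i _ => hY i))
      (integrable_finsetSum _ fun i _ => integrable_imbalanceCost ψp ψm (q i) (hY i))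
      fun ω => imbalanceCost_sum_le hψp hψm _ q fun i => Y i ω
  refine le_of_forall_pos_le_add fun ε hε => ?_
  have hδ : 0 < ε / (m + 1) := by positivity
  choose q hq using fun i => exists_lt_of_ciInf_lt
    (lt_add_of_pos_right (⨅ q : ℝ, ∫ ω, imbalanceCost ψp ψm q (Y i ω) ∂P) hδ)
  refine (pooled_le q).trans ((Finset.sum_le_sum fun i _ => (hq i).le).trans ?_)
  rw [Finset.sum_add_distrib]
  gcongr
  rw [Finset.sum_const, Finset.card_univ, Fintype.card_fin, nsmul_eq_mul, mul_div_assoc',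
    div_le_iff₀ (by positivity)]
  nlinarith
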